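/- Let (m_n)_{n≥1} be any sequence of integers with m_n ≥ 2, and set μ_n = log m_n and t_n = (3·log n)/(2·μ_n). Then the family of m_n-shuffles presents a (t_n, μ_n^{−1}) total variation cutoff: lim_{c→+∞} limsup_{n→∞} ‖Q_{n,m_n}^{⌈t_n + c/μ_n⌉} − U_n‖_TV = 0, and lim_{c→+∞} liminf_{n→∞} ‖Q_{n,m_n}^{k(n,c)} − U_n‖_TV = 1 where k(n,c) = max(⌊t_n − c/μ_n⌋, 0). -/

import Mathlib

open Filter MeasureTheory
open scoped BigOperators NNReal ENNReal

noncomputable section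

/-- The value of `σ⁻¹` at position `i` (0-indexed), as a natural number; `0` out of range. -/
def invAt (n : ℕ) (σ : Equiv.Perm (Fin n)) (i : ℕ) : ℕ :=
  if h : i < n then ((σ⁻¹ ⟨i, h⟩ : Fin n) : ℕ) else 0

/-- The number of rising sequences of a permutation: one plus the number of descents
of its inverse. -/
def rSeq (n : ℕ) (σ : Equiv.Perm (Fin n)) : ℕ :=
  1 + ((Finset.range (n - 1)).filter fun i => invAt n σ (i + 1) < invAt n σ i).card

/-- The `m`-shuffle distribution on `S_n`:  `Q_{n,m}(σ) = m^{-n} C(n + m - r(σ), n)`. -/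
def Qs (n m : ℕ) (σ : Equiv.Perm (Fin n)) : ℝ :=
  ((m : ℝ) ^ n)⁻¹ * (Nat.choose (n + m - rSeq n σ) n : ℝ)

/-- The uniform distribution on `S_n`. -/
def Us (n : ℕ) (_ : Equiv.Perm (Fin n)) : ℝ := (n.factorial : ℝ)⁻¹

/-- Total variation distance between two probability distributions on `S_n`. -/
def tv (n : ℕ) (μ ν : Equiv.Perm (Fin n) → ℝ) : ℝ :=
  (1 / 2) * ∑ σ : Equiv.Perm (Fin n), |μ σ - ν σ|

/-- Convolution of two distributions on `S_n`. -/
def convol (n : ℕ) (μ ν : Equiv.Perm (Fin n) → ℝ) : Equiv.Perm (Fin n) → ℝ :=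
  fun σ => ∑ τ : Equiv.Perm (Fin n), μ (σ * τ⁻¹) * ν τ

/-- `k`-fold convolution power; the `0`-th power is the point mass at the identity. -/
def iterConv (n : ℕ) (μ : Equiv.Perm (Fin n) → ℝ) : ℕ → Equiv.Perm (Fin n) → ℝ
  | 0 => fun σ => if σ = 1 then 1 else 0
  | k + 1 => convol n μ (iterConv n μ k)

/-- `Ψ(x) = (2π)^{-1/2} ∫_{-x/(4√3)}^{x/(4√3)} e^{-t²/2} dt`. -/
def Psi (x : ℝ) : ℝ :=
  (Real.sqrt (2 * Real.pi))⁻¹ *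
    ∫ t in (-(x / (4 * Real.sqrt 3)))..(x / (4 * Real.sqrt 3)), Real.exp (-t ^ 2 / 2)

/-- The `p`-shuffle distribution on `S_n` for a probability `p` on the positive integers. -/
def Qp (n : ℕ) (p : ℕ → ℝ) (σ : Equiv.Perm (Fin n)) : ℝ := ∑' m : ℕ, p m * Qs n m σ

/-- The word `w` is sorted stably by `σ⁻¹`: the pairs `(w (σ⁻¹ i), σ⁻¹ i)` increase
lexicographically. -/
def IsSort {n : ℕ} {α : Type} [LinearOrder α] (σ : Equiv.Perm (Fin n)) (w : Fin n → α) : Prop :=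
  StrictMono fun i => toLex (w (σ⁻¹ i), σ⁻¹ i)

lemma isSort_iff_lt_iff {n : ℕ} {α : Type} [LinearOrder α] {σ : Equiv.Perm (Fin n)}
    {w : Fin n → α} :
    IsSort σ w ↔ ∀ i j, σ i < σ j ↔ w i < w j ∨ w i = w j ∧ i < j := by
  constructor
  · intro h i j
    rw [← h.lt_iff_lt]
    simp [Prod.Lex.toLex_lt_toLex]
  · intro h i j hij
    have := (h (σ⁻¹ i) (σ⁻¹ j)).1 (by simpa using hij)
    simpa [Prod.Lex.toLex_lt_toLex] using this

lemma isSort_iff_eq_sort {n : ℕ} {α : Type} [LinearOrder α] {σ : Equiv.Perm (Fin n)}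
    {w : Fin n → α} : IsSort σ w ↔ σ⁻¹ = Tuple.sort w := by
  rw [Tuple.eq_sort_iff']
  rfl

lemma IsSort.unique {n : ℕ} {α : Type} [LinearOrder α] {σ τ : Equiv.Perm (Fin n)}
    {w : Fin n → α} (hσ : IsSort σ w) (hτ : IsSort τ w) : σ = τ := by
  rw [isSort_iff_eq_sort] at hσ hτ
  exact inv_injective (hσ.trans hτ.symm)

/-- The number of words over `α` sorted stably by `σ⁻¹`. -/
def wordCount {n : ℕ} (α : Type) [LinearOrder α] (σ : Equiv.Perm (Fin n)) : ℕ :=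
  Nat.card {w : Fin n → α // IsSort σ w}

lemma wordCount_congr {n : ℕ} {α β : Type} [LinearOrder α] [LinearOrder β] (e : α ≃o β)
    (σ : Equiv.Perm (Fin n)) : wordCount α σ = wordCount β σ := by
  refine Nat.card_congr ((Equiv.arrowCongr (Equiv.refl _) e.toEquiv).subtypeEquiv fun w => ?_)
  simp [isSort_iff_lt_iff]

lemma isSort_lex_iff {n : ℕ} {α β : Type} [LinearOrder α] [LinearOrder β]
    {σ τ : Equiv.Perm (Fin n)} {v : Fin n → α} {w : Fin n → β} (hw : IsSort τ w) :
    IsSort (σ * τ⁻¹) v ↔ IsSort σ fun i => toLex (v (τ i), w i) := by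
  rw [isSort_iff_lt_iff] at hw
  have hinv (i : Fin n) : τ⁻¹ (τ i) = i := by simp
  simp only [isSort_iff_lt_iff]
  rw [← τ.forall_congr_right]
  refine forall_congr' fun i => ?_
  rw [← τ.forall_congr_right]
  refine forall_congr' fun j => ?_
  simp only [Equiv.Perm.mul_apply, hinv, hw, Prod.Lex.toLex_lt_toLex,
    EmbeddingLike.apply_eq_iff_eq, Prod.mk.injEq]
  tauto

lemma wordCount_lex {n : ℕ} (α β : Type) [LinearOrder α] [LinearOrder β] [Finite α] [Finite β]
    (σ : Equiv.Perm (Fin n)) :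
    wordCount (α ×ₗ β) σ = ∑ τ, wordCount α (σ * τ⁻¹) * wordCount β τ := by
  simp only [wordCount]
  simp_rw [← Nat.card_prod]
  rw [← Nat.card_sigma]
  symm
  refine Nat.card_congr (Equiv.ofBijective (fun x => ⟨fun i => toLex (x.2.1.1 (x.1 i), x.2.2.1 i),
    (isSort_lex_iff x.2.2.2).1 x.2.1.2⟩) ⟨?_, ?_⟩)
  · rintro ⟨τ, ⟨v, hv⟩, ⟨w, hw⟩⟩ ⟨τ', ⟨v', hv'⟩, ⟨w', hw'⟩⟩ h
    simp only [Subtype.mk.injEq, funext_iff, EmbeddingLike.apply_eq_iff_eq, Prod.mk.injEq] at h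
    obtain rfl : w = w' := funext fun i => (h i).2
    obtain rfl := hw.unique hw'
    obtain rfl : v = v' := funext fun i => by simpa using (h (τ⁻¹ i)).1
    rfl
  · rintro ⟨u, hu⟩
    have hw : IsSort (Tuple.sort fun i => (ofLex (u i)).2)⁻¹ fun i => (ofLex (u i)).2 := by
      rw [isSort_iff_eq_sort, inv_inv]
    set τ := (Tuple.sort fun i => (ofLex (u i)).2)⁻¹
    refine ⟨⟨τ, ⟨fun i => (ofLex (u (τ⁻¹ i))).1, ?_⟩, ⟨_, hw⟩⟩, ?_⟩
    · rw [isSort_lex_iff hw]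
      simpa using hu
    · simp

lemma sum_wordCount {n : ℕ} (m : ℕ) :
    ∑ σ : Equiv.Perm (Fin n), wordCount (Fin m) σ = m ^ n := by
  simp only [wordCount]
  rw [← Nat.card_sigma]
  have e : (Σ σ : Equiv.Perm (Fin n), {w : Fin n → Fin m // IsSort σ w}) ≃ (Fin n → Fin m) :=
    Equiv.ofBijective (fun x => x.2.1) ⟨by
      rintro ⟨τ, ⟨v, hv⟩⟩ ⟨τ', ⟨v', hv'⟩⟩ rfl
      obtain rfl := hv.unique hv'
      rfl, fun w => ⟨⟨(Tuple.sort w)⁻¹, ⟨w, by rw [isSort_iff_eq_sort, inv_inv]⟩⟩, rfl⟩⟩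
  rw [Nat.card_congr e]
  simp

lemma wordCount_one {n : ℕ} (σ : Equiv.Perm (Fin n)) :
    wordCount (Fin 1) σ = if σ = 1 then 1 else 0 := by
  have h (w : Fin n → Fin 1) : IsSort σ w ↔ σ = 1 := by
    rw [isSort_iff_eq_sort, Tuple.sort_eq_refl_iff_monotone.2, ← inv_eq_one]
    · rfl
    · exact fun i j _ => (Subsingleton.elim _ _).le
  simp only [wordCount, h]
  split_ifs with hσ <;> simp [hσ]

/-- The number of ascents of `σ⁻¹` among the first `i` steps. -/
def ascCount (n : ℕ) (σ : Equiv.Perm (Fin n)) (i : ℕ) : ℕ :=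
  ((Finset.range i).filter fun i => ¬ invAt n σ (i + 1) < invAt n σ i).card

lemma ascCount_succ (n : ℕ) (σ : Equiv.Perm (Fin n)) (i : ℕ) :
    ascCount n σ (i + 1) =
      ascCount n σ i + if invAt n σ (i + 1) < invAt n σ i then 0 else 1 := by
  unfold ascCount
  rw [Finset.range_add_one, Finset.filter_insert]
  split_ifs <;> simp_all

lemma rSeq_add_ascCount (k : ℕ) (σ : Equiv.Perm (Fin (k + 1))) :
    rSeq (k + 1) σ + ascCount (k + 1) σ k = k + 1 := by
  unfold rSeq ascCount
  rw [add_assoc, Nat.add_sub_cancel, Finset.card_filter_add_card_filter_not, Finset.card_range,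
    add_comm]

lemma isSort_iff_strictMono {k m : ℕ} (σ : Equiv.Perm (Fin (k + 1))) (w : Fin (k + 1) → Fin m) :
    IsSort σ w ↔ StrictMono fun i : Fin (k + 1) =>
      (w (σ⁻¹ i) : ℕ) + ascCount (k + 1) σ i := by
  unfold IsSort
  rw [Fin.strictMono_iff_lt_succ, Fin.strictMono_iff_lt_succ]
  refine forall_congr' fun i => ?_
  have hne : (σ⁻¹ i.castSucc : ℕ) ≠ σ⁻¹ i.succ := fun h => by
    have := σ⁻¹.injective (Fin.ext h)
    simp [Fin.ext_iff] at this
  have h1 : invAt (k + 1) σ i = (σ⁻¹ i.castSucc : ℕ) := by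
    rw [invAt, dif_pos (by omega)]; rfl
  have h2 : invAt (k + 1) σ (i + 1) = (σ⁻¹ i.succ : ℕ) := by
    rw [invAt, dif_pos (by omega)]; rfl
  simp only [Prod.Lex.toLex_lt_toLex, Fin.val_succ, Fin.val_castSucc, ascCount_succ, h1, h2,
    Fin.lt_def, Fin.ext_iff]
  split_ifs <;> omega

lemma ascCount_mono (n : ℕ) (σ : Equiv.Perm (Fin n)) : Monotone (ascCount n σ) :=
  monotone_nat_of_le_succ fun i => by rw [ascCount_succ]; omega

lemma wordCount_eq_choose {n : ℕ} (hn : 0 < n) (m : ℕ) (σ : Equiv.Perm (Fin n)) :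
    wordCount (Fin m) σ = (n + m - rSeq n σ).choose n := by
  obtain ⟨k, rfl⟩ := Nat.exists_eq_succ_of_ne_zero hn.ne'
  simp only [Nat.succ_eq_add_one] at *
  have hr := rSeq_add_ascCount k σ
  set N := k + 1 + m - rSeq (k + 1) σ with hN
  have hN' : N = m + ascCount (k + 1) σ k := by omega
  have hcard : Nat.card (Fin (k + 1) ↪o Fin N) = N.choose (k + 1) := by
    rw [Nat.card_congr Set.powersetCard.ofFinEmbEquiv, Set.powersetCard.card, Nat.card_fin]
  rw [← hcard]
  have hasc (i : Fin (k + 1)) : ascCount (k + 1) σ i ≤ ascCount (k + 1) σ k :=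
    ascCount_mono _ _ (by omega)
  refine Nat.card_congr (Equiv.ofBijective (fun w => OrderEmbedding.ofStrictMono
    (fun i => (⟨(w.1 (σ⁻¹ i) : ℕ) + ascCount (k + 1) σ i, by
      have := hasc i
      have := (w.1 (σ⁻¹ i)).2
      omega⟩ : Fin N))
    fun i j hij => (isSort_iff_strictMono σ w.1).1 w.2 hij) ⟨?_, ?_⟩)
  · rintro ⟨v, hv⟩ ⟨w, hw⟩ h
    refine Subtype.ext (funext fun i => ?_)
    have := DFunLike.congr_fun h (σ i)
    simpa [Fin.ext_iff] using this
  · intro g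
    have hg := Fin.strictMono_iff_lt_succ.1 g.strictMono
    have hlow (i : Fin (k + 1)) : ascCount (k + 1) σ i ≤ g i := by
      induction i using Fin.induction with
      | zero => simp [ascCount]
      | succ i ih =>
        have h1 := hg i
        have h2 := ascCount_succ (k + 1) σ i
        simp only [Fin.lt_def, Fin.val_castSucc, Fin.val_succ] at *
        split_ifs at h2 <;> omega
    have hmono : Monotone fun i : Fin (k + 1) => (g i : ℕ) - ascCount (k + 1) σ i := by
      rw [Fin.monotone_iff_le_succ]
      intro i
      have h1 := hg i
      have h2 := ascCount_succ (k + 1) σ i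
      simp only [Fin.lt_def, Fin.val_castSucc, Fin.val_succ] at *
      split_ifs at h2 <;> omega
    have hup (i : Fin (k + 1)) : (g i : ℕ) - ascCount (k + 1) σ i < m := by
      have h1 := hmono (Fin.le_last i)
      have h2 := (g (Fin.last k)).2
      have h3 := hlow (Fin.last k)
      simp only [Fin.val_last] at h1 h3
      omega
    have hsum (i : Fin (k + 1)) :
        (g i : ℕ) - ascCount (k + 1) σ i + ascCount (k + 1) σ i = g i :=
      Nat.sub_add_cancel (hlow i)
    refine ⟨⟨fun i => ⟨(g (σ i) : ℕ) - ascCount (k + 1) σ (σ i), hup (σ i)⟩, ?_⟩, ?_⟩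
    · rw [isSort_iff_strictMono]
      refine fun i j hij => ?_
      have hinv (i : Fin (k + 1)) : σ (σ⁻¹ i) = i := by simp
      simpa only [hinv, hsum] using Fin.lt_def.1 (g.strictMono hij)
    · ext i
      simp [hsum]

lemma Qs_eq_wordCount {n : ℕ} (hn : 0 < n) (m : ℕ) (σ : Equiv.Perm (Fin n)) :
    Qs n m σ = ((m : ℝ) ^ n)⁻¹ * wordCount (Fin m) σ := by
  rw [Qs, wordCount_eq_choose hn]

lemma sum_Qs {n m : ℕ} (hn : 0 < n) (hm : 0 < m) : ∑ σ, Qs n m σ = 1 := by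
  simp_rw [Qs_eq_wordCount hn]
  rw [← Finset.mul_sum, ← Nat.cast_sum, sum_wordCount, Nat.cast_pow]
  exact inv_mul_cancel₀ (by positivity)

lemma convol_Qs {n : ℕ} (hn : 0 < n) (m M : ℕ) :
    convol n (Qs n m) (Qs n M) = Qs n (m * M) := by
  funext σ
  have e : Fin (m * M) ≃o Fin m ×ₗ Fin M :=
    Fintype.orderIsoFinOfCardEq _ (by simp [Lex])
  rw [Qs_eq_wordCount hn, wordCount_congr e, wordCount_lex, convol]
  simp_rw [Qs_eq_wordCount hn]
  push_cast
  rw [Finset.mul_sum, mul_pow, mul_inv]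
  exact Finset.sum_congr rfl fun τ _ => by ring

lemma iterConv_Qs {n : ℕ} (hn : 0 < n) (m k : ℕ) :
    iterConv n (Qs n m) k = Qs n (m ^ k) := by
  induction k with
  | zero =>
    funext σ
    rw [pow_zero, Qs_eq_wordCount hn, wordCount_one]
    simp [iterConv]
  | succ k ih => rw [iterConv, ih, convol_Qs hn, pow_succ']

/-- The centred indicator of a descent of `σ⁻¹` at `i`. -/
def desSign (n : ℕ) (σ : Equiv.Perm (Fin n)) (i : ℕ) : ℝ :=
  if invAt n σ (i + 1) < invAt n σ i then 1 / 2 else -(1 / 2)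

lemma invAt_ne {n : ℕ} (σ : Equiv.Perm (Fin n)) {i : ℕ} (hi : i + 1 < n) :
    invAt n σ (i + 1) ≠ invAt n σ i := by
  rw [invAt, invAt, dif_pos hi, dif_pos (by omega)]
  intro h
  simpa using σ⁻¹.injective (Fin.ext h)

lemma invAt_swap_mul {n : ℕ} (σ : Equiv.Perm (Fin n)) {i : ℕ} (hi : i + 1 < n) (j : ℕ) :
    invAt n (Equiv.swap ⟨i, by omega⟩ ⟨i + 1, hi⟩ * σ) j =
      invAt n σ (if j = i then i + 1 else if j = i + 1 then i else j) := by
  unfold invAt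
  by_cases hj : j < n
  · have h : (if j = i then i + 1 else if j = i + 1 then i else j) < n := by
      split_ifs <;> omega
    rw [dif_pos hj, dif_pos h, mul_inv_rev, Equiv.swap_inv, Equiv.Perm.mul_apply,
      Equiv.swap_apply_def]
    congr 2
    simp only [Fin.ext_iff]
    split_ifs <;> rfl
  · rw [dif_neg hj, dif_neg]
    split_ifs <;> omega

lemma sum_desSign_mul_eq_zero {n i j : ℕ} (hi : i + 1 < n) (hij : j + 1 < i ∨ i + 1 < j) :
    ∑ σ, desSign n σ i * desSign n σ j = 0 := by
  have h : ∑ σ, desSign n σ i * desSign n σ j = -∑ σ, desSign n σ i * desSign n σ j := by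
    rw [← Finset.sum_neg_distrib]
    refine Fintype.sum_equiv
      (Equiv.mulLeft (Equiv.swap (⟨i, by omega⟩ : Fin n) ⟨i + 1, hi⟩)) _ _ fun σ => ?_
    have hne := invAt_ne σ hi
    simp only [Equiv.coe_mulLeft, desSign, invAt_swap_mul, if_true]
    rw [if_neg (by omega : ¬ i + 1 = i), if_neg (by omega : ¬ j + 1 = i),
      if_neg (by omega : ¬ j + 1 = i + 1), if_neg (by omega : ¬ j = i),
      if_neg (by omega : ¬ j = i + 1)]
    rcases lt_or_gt_of_ne hne with h | h
    · rw [if_pos h, if_neg h.not_gt]; ring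
    · rw [if_neg h.not_gt, if_pos h]; ring
  linarith

lemma desSign_mul_le (n : ℕ) (σ : Equiv.Perm (Fin n)) (i j : ℕ) :
    desSign n σ i * desSign n σ j ≤ 1 / 4 := by
  unfold desSign
  split_ifs <;> norm_num

lemma rSeq_sub_eq_sum {n : ℕ} (hn : 0 < n) (σ : Equiv.Perm (Fin n)) :
    (rSeq n σ : ℝ) - (n + 1) / 2 = ∑ i ∈ Finset.range (n - 1), desSign n σ i := by
  have h (i : ℕ) : desSign n σ i =
      (if invAt n σ (i + 1) < invAt n σ i then 1 else 0) - 1 / 2 := by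
    unfold desSign
    split_ifs <;> norm_num
  simp_rw [h, rSeq]
  rw [Finset.sum_sub_distrib, Finset.sum_boole, Finset.sum_const, Finset.card_range, nsmul_eq_mul]
  push_cast [Nat.cast_sub (show 1 ≤ n from hn)]
  ring

lemma sum_rSeq_sub_sq_le {n : ℕ} (hn : 0 < n) :
    ∑ σ, ((rSeq n σ : ℝ) - (n + 1) / 2) ^ 2 ≤ (n.factorial : ℝ) * n := by
  simp_rw [rSeq_sub_eq_sum hn, sq, Finset.sum_mul_sum]
  rw [Finset.sum_comm]
  have key : ∀ i ∈ Finset.range (n - 1),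
      ∑ σ, ∑ j ∈ Finset.range (n - 1), desSign n σ i * desSign n σ j ≤ n.factorial := by
    intro i hi
    rw [Finset.mem_range] at hi
    rw [Finset.sum_comm]
    calc ∑ j ∈ Finset.range (n - 1), ∑ σ, desSign n σ i * desSign n σ j
        ≤ ∑ j ∈ Finset.range (n - 1),
            if j ∈ Finset.Icc (i - 1) (i + 1) then (n.factorial : ℝ) / 4 else 0 := by
          refine Finset.sum_le_sum fun j _ => ?_
          split_ifs with hj
          · refine (Finset.sum_le_sum fun σ _ => desSign_mul_le n σ i j).trans_eq ?_
            rw [Finset.sum_const, Finset.card_univ, Fintype.card_perm, Fintype.card_fin,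
              nsmul_eq_mul]
            ring
          · rw [Finset.mem_Icc] at hj
            exact (sum_desSign_mul_eq_zero (by omega) (by omega)).le
      _ ≤ ∑ j ∈ Finset.Icc (i - 1) (i + 1), (n.factorial : ℝ) / 4 := by
          rw [← Finset.sum_filter]
          refine Finset.sum_le_sum_of_subset_of_nonneg (fun j hj => (Finset.mem_filter.1 hj).2)
            fun _ _ _ => by positivity
      _ ≤ n.factorial := by
          rw [Finset.sum_const, Nat.card_Icc, nsmul_eq_mul]
          have : ((i + 1 + 1 - (i - 1) : ℕ) : ℝ) ≤ 3 := by
            exact_mod_cast (by omega : i + 1 + 1 - (i - 1) ≤ 3)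
          have hf : (0 : ℝ) ≤ n.factorial := by positivity
          nlinarith
  refine (Finset.sum_le_sum key).trans ?_
  rw [Finset.sum_const, Finset.card_range, nsmul_eq_mul, mul_comm]
  gcongr
  omega

lemma rSeq_le {n : ℕ} (hn : 0 < n) (σ : Equiv.Perm (Fin n)) : rSeq n σ ≤ n := by
  have := Finset.card_filter_le (Finset.range (n - 1))
    fun i => invAt n σ (i + 1) < invAt n σ i
  rw [Finset.card_range] at this
  unfold rSeq
  omega

lemma factorial_mul_Qs {n m : ℕ} {σ : Equiv.Perm (Fin n)} (hr : rSeq n σ ≤ m) :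
    n.factorial * Qs n m σ =
      ∏ i ∈ Finset.range n, (((m : ℝ) + (i + 1) - rSeq n σ) / m) := by
  have h : (n.factorial : ℝ) * ((n + m - rSeq n σ).choose n : ℕ) =
      ∏ i ∈ Finset.range n, ((m : ℝ) + (i + 1) - rSeq n σ) := by
    rw [show n + m - rSeq n σ = m - rSeq n σ + n by omega, ← Nat.cast_mul,
      ← Nat.ascFactorial_eq_factorial_mul_choose, Nat.ascFactorial_eq_prod_range]
    push_cast [Nat.cast_sub hr]
    exact Finset.prod_congr rfl fun i _ => by ring
  rw [Finset.prod_div_distrib, ← h, Finset.prod_const, Finset.card_range, Qs]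
  ring

lemma Qs_eq_zero {n m : ℕ} {σ : Equiv.Perm (Fin n)} (hn : 0 < n) (hr : m < rSeq n σ) :
    Qs n m σ = 0 := by
  rw [Qs, Nat.choose_eq_zero_of_lt (by omega)]
  simp

lemma Qs_nonneg (n m : ℕ) (σ : Equiv.Perm (Fin n)) : 0 ≤ Qs n m σ := by
  unfold Qs
  positivity

lemma sum_range_centered (n : ℕ) (s : ℝ) :
    ∑ i ∈ Finset.range n, ((i : ℝ) + 1 - s) = n * ((n + 1) / 2 - s) := by
  induction n with
  | zero => simp
  | succ n ih => rw [Finset.sum_range_succ, ih]; push_cast; ring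

lemma sum_range_centered_sq (n : ℕ) :
    ∑ i ∈ Finset.range n, ((i : ℝ) + 1 - (n + 1) / 2) ^ 2 =
      (n : ℝ) * ((n : ℝ) ^ 2 - 1) / 12 := by
  have h (x : ℝ) : ∑ i ∈ Finset.range n, ((i : ℝ) + 1 - x) ^ 2 =
      n * (n + 1) * (2 * n + 1) / 6 - x * n * (n + 1) + n * x ^ 2 := by
    induction n with
    | zero => simp
    | succ n ih => rw [Finset.sum_range_succ, ih]; push_cast; ring
  rw [h]
  ring

lemma exp_sub_two_mul_sq_le {x : ℝ} (hx : -(1 / 2) ≤ x) : Real.exp (x - 2 * x ^ 2) ≤ 1 + x := by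
  have h0 : 0 < 1 + x := by linarith
  rw [← Real.le_log_iff_exp_le h0]
  refine le_trans ?_ (Real.one_sub_inv_le_log_of_pos h0)
  rw [← sub_nonneg]
  have : 1 - (1 + x)⁻¹ - (x - 2 * x ^ 2) = x ^ 2 * (1 + 2 * x) / (1 + x) := by
    field_simp
    ring
  rw [this]
  have : 0 ≤ 1 + 2 * x := by linarith
  positivity

lemma one_sub_factorial_mul_Qs_le {n m : ℕ} (hn : 0 < n) (hm : 2 * n ≤ m)
    (σ : Equiv.Perm (Fin n)) :
    1 - n.factorial * Qs n m σ ≤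
      n * |(rSeq n σ : ℝ) - (n + 1) / 2| / m + 2 * n ^ 3 / m ^ 2 := by
  have hr := rSeq_le hn σ
  have hm0 : (0 : ℝ) < m := by exact_mod_cast (by omega : 0 < m)
  have hr' : (rSeq n σ : ℝ) ≤ n := by exact_mod_cast hr
  have hm' : 2 * (n : ℝ) ≤ m := by exact_mod_cast hm
  have hr1 : (1 : ℝ) ≤ rSeq n σ := by exact_mod_cast (by unfold rSeq; omega : 1 ≤ rSeq n σ)
  rw [factorial_mul_Qs (by omega)]
  set x : ℕ → ℝ := fun i => ((i : ℝ) + 1 - rSeq n σ) / m with hx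
  have hxn : ∀ i ∈ Finset.range n, |x i| ≤ n / m := by
    intro i hi
    have hi' : (i : ℝ) + 1 ≤ n := by exact_mod_cast Finset.mem_range.1 hi
    have hi0 : (0 : ℝ) ≤ i := by positivity
    rw [hx, abs_div, abs_of_pos hm0]
    gcongr
    rw [abs_le]
    constructor <;> linarith
  have hnm : (n : ℝ) / m ≤ 1 / 2 := by
    rw [div_le_iff₀ hm0]; linarith
  have hexp : Real.exp (∑ i ∈ Finset.range n, (x i - 2 * x i ^ 2)) ≤
      ∏ i ∈ Finset.range n, (((m : ℝ) + (i + 1) - rSeq n σ) / m) := by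
    rw [Real.exp_sum]
    refine Finset.prod_le_prod (fun _ _ => (Real.exp_pos _).le) fun i hi => ?_
    refine (exp_sub_two_mul_sq_le ?_).trans_eq ?_
    · have := (abs_le.1 (hxn i hi)).1
      linarith
    · rw [hx]
      field_simp
      ring
  have hsum : ∑ i ∈ Finset.range n, x i = -(n * ((rSeq n σ : ℝ) - (n + 1) / 2) / m) := by
    rw [hx, ← Finset.sum_div, sum_range_centered]
    ring
  have hsq : ∑ i ∈ Finset.range n, 2 * x i ^ 2 ≤ 2 * (n : ℝ) ^ 3 / (m : ℝ) ^ 2 := by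
    calc ∑ i ∈ Finset.range n, 2 * x i ^ 2 ≤ ∑ i ∈ Finset.range n, 2 * ((n : ℝ) / m) ^ 2 := by
          refine Finset.sum_le_sum fun i hi => ?_
          have := sq_le_sq' (abs_le.1 (hxn i hi)).1 (abs_le.1 (hxn i hi)).2
          linarith
      _ = 2 * (n : ℝ) ^ 3 / (m : ℝ) ^ 2 := by
          rw [Finset.sum_const, Finset.card_range, nsmul_eq_mul]
          ring
  have h1 := Real.add_one_le_exp (∑ i ∈ Finset.range n, (x i - 2 * x i ^ 2))
  rw [Finset.sum_sub_distrib] at h1 hexp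
  have h2 : n * ((rSeq n σ : ℝ) - (n + 1) / 2) / m ≤
      n * |(rSeq n σ : ℝ) - (n + 1) / 2| / m := by
    gcongr
    exact le_abs_self _
  linarith

lemma sum_Us (n : ℕ) : ∑ σ, Us n σ = 1 := by
  simp only [Us, Finset.sum_const, Finset.card_univ, Fintype.card_perm, Fintype.card_fin,
    nsmul_eq_mul]
  exact mul_inv_cancel₀ (by positivity)

lemma tv_Qs_eq {n m : ℕ} (hn : 0 < n) (hm : 0 < m) :
    tv n (Qs n m) (Us n) = ∑ σ, max (Us n σ - Qs n m σ) 0 := by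
  have h (σ : Equiv.Perm (Fin n)) : |Qs n m σ - Us n σ| =
      2 * max (Us n σ - Qs n m σ) 0 + (Qs n m σ - Us n σ) := by
    rcases le_total (Qs n m σ) (Us n σ) with h | h
    · rw [abs_of_nonpos (by linarith), max_eq_left (by linarith)]; ring
    · rw [abs_of_nonneg (by linarith), max_eq_right (by linarith)]; ring
  simp_rw [tv, h]
  rw [Finset.sum_add_distrib, Finset.sum_sub_distrib, sum_Qs hn hm, sum_Us, ← Finset.mul_sum]
  ring

lemma Us_sub_Qs (n m : ℕ) (σ : Equiv.Perm (Fin n)) :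
    Us n σ - Qs n m σ = (n.factorial : ℝ)⁻¹ * (1 - n.factorial * Qs n m σ) := by
  have : (n.factorial : ℝ) ≠ 0 := by positivity
  rw [Us]
  field_simp

lemma tv_Qs_le_one {n m : ℕ} (hn : 0 < n) (hm : 0 < m) : tv n (Qs n m) (Us n) ≤ 1 := by
  rw [tv_Qs_eq hn hm, ← sum_Us n]
  refine Finset.sum_le_sum fun σ _ => max_le ?_ ?_
  · linarith [Qs_nonneg n m σ]
  · unfold Us; positivity

lemma tv_nonneg (n : ℕ) (μ ν : Equiv.Perm (Fin n) → ℝ) : 0 ≤ tv n μ ν := by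
  unfold tv
  positivity

lemma tv_Qs_le {n m : ℕ} (hn : 0 < n) (hm : 2 * n ≤ m) :
    tv n (Qs n m) (Us n) ≤ n * √n / m + 2 * (n * √n / m) ^ 2 := by
  have hm0 : (0 : ℝ) < m := by exact_mod_cast (by omega : 0 < m)
  have hs0 : 0 < √(n : ℝ) := Real.sqrt_pos.2 (by exact_mod_cast hn)
  have hs2 : √(n : ℝ) ^ 2 = n := Real.sq_sqrt (by positivity)
  have hf : (0 : ℝ) < n.factorial := by positivity
  rw [tv_Qs_eq hn (by omega)]
  calc ∑ σ, max (Us n σ - Qs n m σ) 0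
      ≤ ∑ σ : Equiv.Perm (Fin n), (n.factorial : ℝ)⁻¹ * (n * ((√n +
          ((rSeq n σ : ℝ) - (n + 1) / 2) ^ 2 / √n) / 2) / m + 2 * n ^ 3 / m ^ 2) := by
        refine Finset.sum_le_sum fun σ _ => ?_
        have habs : |(rSeq n σ : ℝ) - (n + 1) / 2| ≤
            (√n + ((rSeq n σ : ℝ) - (n + 1) / 2) ^ 2 / √n) / 2 := by
          set s := (rSeq n σ : ℝ) - (n + 1) / 2
          have : (√n + s ^ 2 / √n) / 2 = |s| + (√n - |s|) ^ 2 / (2 * √n) := by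
            field_simp
            rw [← sq_abs s]
            ring
          rw [this]
          have : 0 ≤ (√(n : ℝ) - |s|) ^ 2 / (2 * √n) := by positivity
          linarith
        refine max_le ?_ (by positivity)
        rw [Us_sub_Qs]
        gcongr
        refine (one_sub_factorial_mul_Qs_le hn hm σ).trans ?_
        gcongr
    _ = n * ((√n + ((n.factorial : ℝ)⁻¹ * ∑ σ : Equiv.Perm (Fin n),
          ((rSeq n σ : ℝ) - (n + 1) / 2) ^ 2) / √n) / 2) / m + 2 * n ^ 3 / m ^ 2 := by
        rw [← Finset.mul_sum, Finset.sum_add_distrib, ← Finset.sum_div, ← Finset.mul_sum,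
          ← Finset.sum_div, Finset.sum_add_distrib, ← Finset.sum_div]
        simp only [Finset.sum_const, Finset.card_univ, Fintype.card_perm, Fintype.card_fin,
          nsmul_eq_mul]
        generalize ∑ σ : Equiv.Perm (Fin n), ((rSeq n σ : ℝ) - (n + 1) / 2) ^ 2 = S
        field_simp
    _ ≤ n * ((√n + n / √n) / 2) / m + 2 * n ^ 3 / m ^ 2 := by
        gcongr
        rw [inv_mul_le_iff₀ hf]
        exact sum_rSeq_sub_sq_le hn
    _ = n * √n / m + 2 * (n * √n / m) ^ 2 := by
        have : (n : ℝ) / √n = √n := by rw [Real.div_sqrt]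
        rw [this, div_pow, mul_pow, hs2]
        ring

lemma factorial_mul_Qs_le {n m : ℕ} (hn : 0 < n) (hm : 0 < m) (σ : Equiv.Perm (Fin n)) :
    n.factorial * Qs n m σ ≤ Real.exp (n * |(rSeq n σ : ℝ) - (n + 1) / 2| / m +
      n * ((rSeq n σ : ℝ) - (n + 1) / 2) ^ 2 / (2 * m ^ 2) - n * (n ^ 2 - 1) / (24 * m ^ 2)) := by
  rcases lt_or_ge m (rSeq n σ) with hr | hr
  · rw [Qs_eq_zero hn hr, mul_zero]
    positivity
  have hm0 : (0 : ℝ) < m := by exact_mod_cast hm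
  have hr' : (rSeq n σ : ℝ) ≤ m := by exact_mod_cast hr
  refine le_of_sq_le_sq ?_ (Real.exp_pos _).le
  rw [← Real.exp_nat_mul, sq, factorial_mul_Qs hr]
  nth_rewrite 2 [← Finset.prod_range_reflect]
  rw [← Finset.prod_mul_distrib]
  set s := (rSeq n σ : ℝ) - (n + 1) / 2 with hs
  calc _ ≤ ∏ i ∈ Finset.range n, Real.exp (-2 * s / m + s ^ 2 / m ^ 2 -
        ((i : ℝ) + 1 - (n + 1) / 2) ^ 2 / m ^ 2) := by
        refine Finset.prod_le_prod (fun i hi => ?_) fun i hi => ?_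
        · have h1 : (0 : ℝ) ≤ i := by positivity
          have h2 : (0 : ℝ) ≤ (n - 1 - i : ℕ) := by positivity
          exact mul_nonneg (div_nonneg (by linarith) hm0.le) (div_nonneg (by linarith) hm0.le)
        · refine le_trans (le_of_eq ?_) (Real.add_one_le_exp _)
          have hi' := Finset.mem_range.1 hi
          rw [Nat.cast_sub (by omega), Nat.cast_sub (by omega),
            show (rSeq n σ : ℝ) = s + (n + 1) / 2 by rw [hs]; ring]
          field_simp
          push_cast
          ring
    _ ≤ _ := by
        rw [← Real.exp_sum]
        refine Real.exp_le_exp.2 ?_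
        rw [Finset.sum_sub_distrib, ← Finset.sum_div, sum_range_centered_sq, Finset.sum_const,
          Finset.card_range, nsmul_eq_mul]
        have h1 : n * (-s) / m ≤ n * |s| / m := by
          gcongr
          exact neg_le_abs s
        have h2 : (n : ℝ) * (-2 * s / m + s ^ 2 / m ^ 2) - n * (n ^ 2 - 1) / 12 / m ^ 2 =
          2 * (n * (-s) / m + n * s ^ 2 / (2 * m ^ 2) - n * (n ^ 2 - 1) / (24 * m ^ 2)) := by
          field_simp
          ring
        rw [h2]
        push_cast
        linarith

lemma factorial_mul_Qs_le_of_abs_le {n m : ℕ} {b : ℝ} (hn : 2 ≤ n) (hm : 0 < m) (hb : 0 < b)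
    (hbn : 48 * (b / 96) ^ 2 ≤ n) (hbm : b ≤ n * √n / m) {σ : Equiv.Perm (Fin n)}
    (hσ : |(rSeq n σ : ℝ) - (n + 1) / 2| ≤ b / 96 * √n) :
    n.factorial * Qs n m σ ≤ Real.exp (-(b ^ 2 / 96)) := by
  refine (factorial_mul_Qs_le (by omega) hm σ).trans (Real.exp_le_exp.2 ?_)
  have hm0 : (0 : ℝ) < m := by exact_mod_cast hm
  have hn2 : (2 : ℝ) ≤ n := by exact_mod_cast hn
  have hs2 : √(n : ℝ) ^ 2 = n := Real.sq_sqrt (by positivity)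
  rw [← sq_abs]
  set s := |(rSeq n σ : ℝ) - (n + 1) / 2|
  set u := n * √n / m with hu
  have hu2 : u ^ 2 = n ^ 3 / m ^ 2 := by
    rw [hu, div_pow, mul_pow, hs2]
    ring
  have h1 : n * s / m ≤ b / 96 * u := by
    calc n * s / m ≤ n * (b / 96 * √n) / m := by gcongr
      _ = b / 96 * u := by rw [hu]; ring
  have h2 : n * s ^ 2 / (2 * m ^ 2) ≤ u ^ 2 / 96 := by
    calc n * s ^ 2 / (2 * m ^ 2) ≤ n * (b / 96 * √n) ^ 2 / (2 * m ^ 2) := by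
          gcongr
      _ = n * (b / 96) ^ 2 * n / (2 * m ^ 2) := by rw [mul_pow, hs2]; ring
      _ ≤ n * (n / 48) * n / (2 * m ^ 2) := by gcongr; linarith
      _ = u ^ 2 / 96 := by rw [hu2]; ring
  have h3 : u ^ 2 / 32 ≤ n * (n ^ 2 - 1) / (24 * m ^ 2) := by
    rw [hu2, div_div, div_le_div_iff₀ (by positivity) (by positivity)]
    have : (n : ℝ) ^ 3 * 24 ≤ n * (n ^ 2 - 1) * 32 := by
      nlinarith [mul_nonneg (show (0 : ℝ) ≤ n by linarith) (show 0 ≤ (n : ℝ) ^ 2 - 4 by nlinarith)]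
    nlinarith [sq_nonneg (m : ℝ)]
  nlinarith

lemma le_tv_Qs {n m : ℕ} {b : ℝ} (hn : 2 ≤ n) (hm : 0 < m) (hb : 0 < b)
    (hbn : 48 * (b / 96) ^ 2 ≤ n) (hbm : b ≤ n * √n / m) :
    1 - (1 / (b / 96) ^ 2 + Real.exp (-(b ^ 2 / 96))) ≤ tv n (Qs n m) (Us n) := by
  have hn0 : (0 : ℝ) < n := by exact_mod_cast (by omega : 0 < n)
  have hs2 : √(n : ℝ) ^ 2 = n := Real.sq_sqrt hn0.le
  have hf : (0 : ℝ) < n.factorial := by positivity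
  rw [tv_Qs_eq (by omega) hm]
  have hK : 0 < b / 96 := by positivity
  set K := b / 96
  set E := Real.exp (-(b ^ 2 / 96))
  have hE : 0 < E := Real.exp_pos _
  calc 1 - (1 / K ^ 2 + E)
      ≤ 1 - ((n.factorial : ℝ)⁻¹ * (∑ σ : Equiv.Perm (Fin n),
          ((rSeq n σ : ℝ) - (n + 1) / 2) ^ 2) / (K ^ 2 * n) + E) := by
        have h1 : (n.factorial : ℝ)⁻¹ * (∑ σ : Equiv.Perm (Fin n),
          ((rSeq n σ : ℝ) - (n + 1) / 2) ^ 2) ≤ n := by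
          rw [inv_mul_le_iff₀ hf]
          exact sum_rSeq_sub_sq_le (by omega)
        have h2 : 1 / K ^ 2 = n / (K ^ 2 * n) := by field_simp
        rw [h2]
        gcongr
    _ = ∑ σ : Equiv.Perm (Fin n), (n.factorial : ℝ)⁻¹ * (1 -
          (((rSeq n σ : ℝ) - (n + 1) / 2) ^ 2 / (K ^ 2 * n) + E)) := by
        rw [← Finset.mul_sum, Finset.sum_sub_distrib, Finset.sum_add_distrib, ← Finset.sum_div]
        simp only [Finset.sum_const, Finset.card_univ, Fintype.card_perm, Fintype.card_fin,
          nsmul_eq_mul]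
        generalize ∑ σ : Equiv.Perm (Fin n), ((rSeq n σ : ℝ) - (n + 1) / 2) ^ 2 = S
        field_simp
    _ ≤ _ := by
        refine Finset.sum_le_sum fun σ _ => ?_
        rcases le_or_gt |(rSeq n σ : ℝ) - (n + 1) / 2| (K * √n) with h | h
        · refine le_max_of_le_left ?_
          rw [Us_sub_Qs]
          have h1 : n.factorial * Qs n m σ ≤ E :=
            factorial_mul_Qs_le_of_abs_le hn hm hb hbn hbm h
          have h2 : 0 ≤ ((rSeq n σ : ℝ) - (n + 1) / 2) ^ 2 / (K ^ 2 * n) := by positivity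
          gcongr
          linarith
        · refine le_max_of_le_right ?_
          have h1 : 1 ≤ ((rSeq n σ : ℝ) - (n + 1) / 2) ^ 2 / (K ^ 2 * n) := by
            rw [one_le_div (by positivity), ← sq_abs (_ - _)]
            nth_rewrite 1 [← hs2]
            rw [← mul_pow]
            gcongr
          exact mul_nonpos_of_nonneg_of_nonpos (by positivity) (by linarith)

lemma exp_three_halves_log {n : ℕ} (hn : 0 < n) :
    Real.exp (3 * Real.log n / 2) = n * √n := by
  have hn0 : (0 : ℝ) < n := by exact_mod_cast hn
  rw [show 3 * Real.log n / 2 = Real.log n + Real.log n / 2 by ring, Real.exp_add,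
    Real.exp_half, Real.exp_log hn0]

lemma le_pow_ceil {m n : ℕ} (hm : 2 ≤ m) (hn : 0 < n) (c : ℝ) :
    n * √n * Real.exp c ≤
      (m ^ (⌈3 * Real.log n / (2 * Real.log m) + c / Real.log m⌉).toNat : ℕ) := by
  have hlog : 0 < Real.log m := Real.log_pos (by exact_mod_cast hm)
  have hm0 : (0 : ℝ) < m := by exact_mod_cast (by omega : 0 < m)
  set x := 3 * Real.log n / (2 * Real.log m) + c / Real.log m with hx
  have h1 : x ≤ (⌈x⌉.toNat : ℝ) := (Int.le_ceil x).trans (by exact_mod_cast Int.self_le_toNat _)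
  have h2 : x * Real.log m = 3 * Real.log n / 2 + c := by
    rw [hx]
    field_simp
  rw [← exp_three_halves_log hn, ← Real.exp_add, ← h2, Nat.cast_pow]
  nth_rewrite 2 [← Real.exp_log hm0]
  rw [← Real.exp_nat_mul]
  gcongr

lemma pow_floor_le {m n : ℕ} (hm : 2 ≤ m) (hn : 0 < n) {c : ℝ} (hc : c ≤ 3 * Real.log n / 2) :
    (m ^ (⌊3 * Real.log n / (2 * Real.log m) - c / Real.log m⌋).toNat : ℕ) * Real.exp c ≤
      n * √n := by
  have hlog : 0 < Real.log m := Real.log_pos (by exact_mod_cast hm)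
  have hm0 : (0 : ℝ) < m := by exact_mod_cast (by omega : 0 < m)
  set x := 3 * Real.log n / (2 * Real.log m) - c / Real.log m with hx
  have h2 : x * Real.log m = 3 * Real.log n / 2 - c := by
    rw [hx]
    field_simp
  have hx0 : 0 ≤ x := nonneg_of_mul_nonneg_left (by linarith) hlog
  have h1 : (⌊x⌋.toNat : ℝ) ≤ x := by
    rw [Int.floor_toNat]
    exact Nat.floor_le hx0
  rw [← exp_three_halves_log hn, Nat.cast_pow]
  nth_rewrite 1 [← Real.exp_log hm0]
  rw [← Real.exp_nat_mul, ← Real.exp_add]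
  gcongr
  nlinarith

/-- The family of `m_n`-shuffles presents a `(t_n, μ_n⁻¹)` total variation cutoff,
where `μ_n = log m_n` and `t_n = 3 log n / (2 μ_n)`. -/
theorem m_shuffle_window_cutoff (m : ℕ → ℕ) (hm : ∀ n, 2 ≤ m n) :
    Filter.Tendsto (fun c : ℝ =>
      Filter.limsup (fun n : ℕ =>
        tv n (iterConv n (Qs n (m n))
          (⌈3 * Real.log n / (2 * Real.log (m n)) + c / Real.log (m n)⌉).toNat) (Us n))
        Filter.atTop) Filter.atTop (nhds 0) ∧
    Filter.Tendsto (fun c : ℝ =>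
      Filter.liminf (fun n : ℕ =>
        tv n (iterConv n (Qs n (m n))
          (⌊3 * Real.log n / (2 * Real.log (m n)) - c / Real.log (m n)⌋).toNat) (Us n))
        Filter.atTop) Filter.atTop (nhds 1) := by
  have hpow (n k : ℕ) : 0 < m n ^ k := pow_pos (by have := hm n; omega) k
  constructor
  · refine squeeze_zero' (g := fun c => Real.exp (-c) + 2 * Real.exp (-c) ^ 2)
      (Eventually.of_forall fun c => ?_) ?_ ?_
    · refine le_limsup_of_le ⟨1, ?_⟩ fun b hb => ?_
      · rw [eventually_map]
        filter_upwards [eventually_gt_atTop 0] with n hn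
        rw [iterConv_Qs hn]
        exact tv_Qs_le_one hn (hpow _ _)
      · obtain ⟨n, hn⟩ := hb.exists
        exact (tv_nonneg _ _ _).trans hn
    · filter_upwards [eventually_ge_atTop 0] with c hc
      refine limsup_le_of_le ?_ ?_
      · exact isCoboundedUnder_le_of_le atTop fun n => tv_nonneg n _ _
      filter_upwards [eventually_ge_atTop 4] with n hn
      have hn0 : 0 < n := by omega
      rw [iterConv_Qs hn0]
      have hM := le_pow_ceil (hm n) hn0 c
      set M := m n ^ (⌈3 * Real.log n / (2 * Real.log (m n)) + c / Real.log (m n)⌉).toNat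
      have hM0 : (0 : ℝ) < M := by exact_mod_cast hpow _ _
      have h2 : (2 : ℝ) ≤ √n := Real.le_sqrt_of_sq_le (by
        have : (4 : ℝ) ≤ n := by exact_mod_cast hn
        linarith)
      have h2n : 2 * n ≤ M := by
        have : (2 * n : ℝ) ≤ M := by
          have h1 : 1 ≤ Real.exp c := Real.one_le_exp hc
          calc (2 * n : ℝ) = n * 2 * 1 := by ring
            _ ≤ n * √n * Real.exp c := by gcongr
            _ ≤ M := hM
        exact_mod_cast this
      have hu : n * √n / M ≤ Real.exp (-c) := by
        rw [div_le_iff₀ hM0, Real.exp_neg, ← div_eq_inv_mul, le_div_iff₀ (Real.exp_pos c)]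
        exact hM
      refine (tv_Qs_le hn0 h2n).trans ?_
      gcongr
    · have h := Real.tendsto_exp_neg_atTop_nhds_zero
      simpa using h.add ((h.pow 2).const_mul 2)
  · refine tendsto_of_tendsto_of_tendsto_of_le_of_le' (g := fun c =>
      1 - (1 / (Real.exp c / 96) ^ 2 + Real.exp (-(Real.exp c ^ 2 / 96)))) (h := fun _ => 1)
      ?_ tendsto_const_nhds (Eventually.of_forall fun c => ?_) (Eventually.of_forall fun c => ?_)
    · have h1 : Tendsto (fun c => (Real.exp c / 96) ^ 2) atTop atTop :=
        (tendsto_pow_atTop two_ne_zero).comp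
          (Real.tendsto_exp_atTop.atTop_div_const (by norm_num))
      have h2 : Tendsto (fun c => Real.exp c ^ 2 / 96) atTop atTop :=
        ((tendsto_pow_atTop two_ne_zero).comp Real.tendsto_exp_atTop).atTop_div_const
          (by norm_num)
      have h3 := h1.inv_tendsto_atTop.add (Real.tendsto_exp_neg_atTop_nhds_zero.comp h2)
      simpa using h3.const_sub 1
    · refine le_liminf_of_le ?_ ?_
      · refine IsBoundedUnder.isCoboundedUnder_ge ⟨1, ?_⟩
        rw [eventually_map]
        filter_upwards [eventually_gt_atTop 0] with n hn
        rw [iterConv_Qs hn]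
        exact tv_Qs_le_one hn (hpow _ _)
      have hlog : Tendsto (fun n : ℕ => 3 * Real.log n / 2) atTop atTop :=
        ((Real.tendsto_log_atTop.comp tendsto_natCast_atTop_atTop).const_mul_atTop
          (by norm_num : (0 : ℝ) < 3)).atTop_div_const (by norm_num)
      filter_upwards [eventually_ge_atTop 2, hlog.eventually_ge_atTop c,
        tendsto_natCast_atTop_atTop.eventually_ge_atTop (48 * (Real.exp c / 96) ^ 2)]
        with n hn hc hbn
      have hn0 : 0 < n := by omega
      rw [iterConv_Qs hn0]
      refine le_tv_Qs hn (hpow _ _) (Real.exp_pos c) hbn ?_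
      rw [le_div_iff₀ (by exact_mod_cast hpow _ _), mul_comm]
      exact pow_floor_le (hm n) hn0 hc
    · refine liminf_le_of_le ?_ fun b hb => ?_
      · exact isBoundedUnder_of ⟨0, fun n => tv_nonneg n _ _⟩
      · obtain ⟨n, hn, hb⟩ := ((eventually_gt_atTop 0).and hb).exists
        rw [iterConv_Qs hn] at hb
        exact hb.trans (tv_Qs_le_one hn (hpow _ _))
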